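/- arXiv:1209.2195 — 2 statements merged into one kernel-verified Lean document; each statement's English description precedes it below -/
import Mathlib

section
/- Let n ≥ 1 and let Ω be an open subset of ℂ × ℂⁿ with coordinates (t, z¹, …, zⁿ). Let Φ : Ω → ℝ be a C^∞ function; set g_{ij̄} := ∂²Φ/∂z^i∂z̄^j (1 ≤ i, j ≤ n) and assume that the Hermitian matrix g := (g_{ij̄}) is positive definite at every point of Ω; let (g^{j̄i}) denote the entries of g⁻¹. Let ψ : Ω → ℝ be a C^∞ function satisfying the fiberwise Monge–Ampère equation log det g = Φ − ψ on Ω. Then at every point of Ω: −Σ_{i,j} g^{j̄i} ∂²/∂z^i∂z̄^j (∂²Φ/∂t∂t̄) = −∂²Φ/∂t∂t̄ + ∂²ψ/∂t∂t̄ − Σ_{i,j,k,s} g^{s̄i} g^{j̄k} (∂g_{ks̄}/∂t)(∂g_{ij̄}/∂t̄). -/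
open Complex
open scoped ComplexOrder

noncomputable section

/-- Wirtinger derivative `∂u/∂w` in the direction `e`. -/
def wD {E : Type*} [NormedAddCommGroup E] [NormedSpace ℂ E]
    (u : E → ℂ) (e : E) (x : E) : ℂ :=
  (1/2 : ℂ) * (fderiv ℝ u x e - Complex.I * fderiv ℝ u x (Complex.I • e))

/-- Conjugate Wirtinger derivative `∂u/∂w̄` in the direction `e`. -/
def wDbar {E : Type*} [NormedAddCommGroup E] [NormedSpace ℂ E]
    (u : E → ℂ) (e : E) (x : E) : ℂ :=
  (1/2 : ℂ) * (fderiv ℝ u x e + Complex.I * fderiv ℝ u x (Complex.I • e))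

/-- The total space `ℂ × ℂⁿ` with coordinates `(t, z¹, …, zⁿ)`. -/
abbrev Etz (n : ℕ) := ℂ × (Fin n → ℂ)

/-- The coordinate direction `∂/∂t`. -/
def dt (n : ℕ) : Etz n := (1, 0)

/-- The coordinate direction `∂/∂z^i`. -/
def dz (n : ℕ) (i : Fin n) : Etz n := (0, Pi.single i 1)

/-- The fiberwise metric `g_{ij̄} := ∂²Φ/∂z^i∂z̄^j` as a matrix-valued function. -/
def gmet {n : ℕ} (Φ : Etz n → ℝ) (x : Etz n) : Matrix (Fin n) (Fin n) ℂ :=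
  Matrix.of fun i j => wD (wDbar (fun p => (Φ p : ℂ)) (dz n j)) (dz n i) x

/-- The entries `g^{j̄i}` of the inverse metric (the first index is the row index). -/
def ginv {n : ℕ} (Φ : Etz n → ℝ) (x : Etz n) (j i : Fin n) : ℂ :=
  (gmet Φ x)⁻¹ j i

section Wirtinger

variable {E : Type*} [NormedAddCommGroup E] [NormedSpace ℂ E]

/-- The functional `L ↦ (L e + c * L (I • e)) / 2` on real-linear forms; the values `c = -I` and
`c = I` give the Wirtinger derivatives. -/
def wirtinger (c : ℂ) (e : E) : (E →L[ℝ] ℂ) →ₗ[ℂ] ℂ where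
  toFun L := (1/2 : ℂ) * (L e + c * L (Complex.I • e))
  map_add' L M := by simp only [add_apply]; ring
  map_smul' a L := by
    simp only [smul_apply, smul_eq_mul, RingHom.id_apply]; ring

lemma wirtinger_apply (c : ℂ) (e : E) (L : E →L[ℝ] ℂ) :
    wirtinger c e L = (1/2 : ℂ) * (L e + c * L (Complex.I • e)) := rfl

lemma wD_eq_wirtinger (u : E → ℂ) (e : E) :
    wD u e = fun x => wirtinger (-Complex.I) e (fderiv ℝ u x) := by
  funext x
  rw [wirtinger_apply, wD]
  ring

lemma wDbar_eq_wirtinger (u : E → ℂ) (e : E) :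
    wDbar u e = fun x => wirtinger Complex.I e (fderiv ℝ u x) := rfl

lemma wirtinger_fderiv_congr {Ω : Set E} (hΩ : IsOpen Ω) {u v : E → ℂ} (h : Set.EqOn u v Ω)
    (c : ℂ) (e : E) {x : E} (hx : x ∈ Ω) :
    wirtinger c e (fderiv ℝ u x) = wirtinger c e (fderiv ℝ v x) := by
  rw [(h.eventuallyEq_of_mem (hΩ.mem_nhds hx)).fderiv_eq]

lemma ContDiffOn.wirtinger_fderiv {Ω : Set E} (hΩ : IsOpen Ω) {u : E → ℂ}
    (hu : ContDiffOn ℝ (⊤ : ℕ∞) u Ω) (c : ℂ) (e : E) :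
    ContDiffOn ℝ (⊤ : ℕ∞) (fun x => wirtinger c e (fderiv ℝ u x)) Ω := by
  have h : ContDiffOn ℝ (⊤ : ℕ∞) (fderiv ℝ u) Ω := hu.fderiv_of_isOpen hΩ (by simp)
  simp only [wirtinger_apply]
  have h' (v : E) : ContDiffOn ℝ (⊤ : ℕ∞) (fun x => fderiv ℝ u x v) Ω :=
    h.clm_apply contDiffOn_const
  exact contDiffOn_const.mul ((h' _).add (contDiffOn_const.mul (h' _)))

lemma ContDiffOn.differentiableAt_of_isOpen {Ω : Set E} (hΩ : IsOpen Ω) {u : E → ℂ}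
    (hu : ContDiffOn ℝ (⊤ : ℕ∞) u Ω) {x : E} (hx : x ∈ Ω) : DifferentiableAt ℝ u x :=
  (hu.contDiffAt (hΩ.mem_nhds hx)).differentiableAt (by simp)

lemma wirtinger_fderiv_comm {Ω : Set E} (hΩ : IsOpen Ω) {u : E → ℂ}
    (hu : ContDiffOn ℝ (⊤ : ℕ∞) u Ω) (c d : ℂ) (e f : E) {x : E} (hx : x ∈ Ω) :
    wirtinger c e (fderiv ℝ (fun y => wirtinger d f (fderiv ℝ u y)) x) =
      wirtinger d f (fderiv ℝ (fun y => wirtinger c e (fderiv ℝ u y)) x) := by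
  have hx' := hu.contDiffAt (hΩ.mem_nhds hx)
  have hsymm : IsSymmSndFDerivAt ℝ u x := hx'.isSymmSndFDerivAt <| by
    rw [minSmoothness_of_isRCLikeNormedField]
    exact WithTop.coe_le_coe.2 (le_top : (2 : ℕ∞) ≤ ⊤)
  have hd : DifferentiableAt ℝ (fderiv ℝ u) x :=
    (hx'.fderiv_right (m := (⊤ : ℕ∞)) (by simp)).differentiableAt (by simp)
  have key (d : ℂ) (f v : E) : fderiv ℝ (fun y => wirtinger d f (fderiv ℝ u y)) x v =
      wirtinger d f (fderiv ℝ (fderiv ℝ u) x v) := by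
    simp only [wirtinger_apply]
    have h' (w : E) : HasFDerivAt (fun y => fderiv ℝ u y w)
        ((fderiv ℝ (fderiv ℝ u) x).flip w) x := by
      simpa using hd.hasFDerivAt.clm_apply (hasFDerivAt_const w x)
    rw [(((h' f).fun_add ((h' (Complex.I • f)).const_mul d)).const_mul (1/2 : ℂ)).fderiv]
    simp [mul_add]
  rw [wirtinger_apply, wirtinger_apply d f, key, key, key, key]
  simp only [wirtinger_apply]
  rw [hsymm f e, hsymm f, hsymm _ e, hsymm (Complex.I • f)]
  ring

end Wirtinger

section Jacobi

variable {E ι : Type*} [NormedAddCommGroup E] [NormedSpace ℝ E] [Fintype ι] [DecidableEq ι]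

/-- Jacobi's formula for the derivative of a determinant. -/
lemma HasFDerivAt.matrix_det {A : E → Matrix ι ι ℂ} {A' : ι → ι → E →L[ℝ] ℂ} {x : E}
    (hA : ∀ i j, HasFDerivAt (fun y => A y i j) (A' i j) x) :
    HasFDerivAt (fun y => (A y).det) (∑ i, ∑ j, (A x).adjugate j i • A' i j) x := by
  simp only [Matrix.det_apply']
  refine (HasFDerivAt.fun_sum fun σ _ => (HasFDerivAt.finsetProd (u := Finset.univ)
    fun i _ => hA (σ i) i).const_mul _).congr_fderiv ?_
  ext v
  simp only [sum_apply, smul_apply, smul_eq_mul]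
  have h (j : ι) : ∑ i, (A x).adjugate j i * A' i j v =
      ((A x).updateCol j fun i => A' i j v).det := by
    rw [← Matrix.cramer_apply, Matrix.cramer_eq_adjugate_mulVec]
    rfl
  rw [Finset.sum_comm (s := Finset.univ) (t := Finset.univ)
    (f := fun i j => (A x).adjugate j i * A' i j v)]
  simp only [h, Matrix.det_apply']
  rw [Finset.sum_comm]
  refine Finset.sum_congr rfl fun σ _ => ?_
  rw [Finset.mul_sum]
  refine Finset.sum_congr rfl fun j _ => ?_
  rw [← Finset.mul_prod_erase _ _ (Finset.mem_univ j), Matrix.updateCol_self, mul_comm (A' _ _ v)]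
  congr 2
  refine Finset.prod_congr rfl fun k hk => ?_
  rw [Matrix.updateCol_ne (Finset.ne_of_mem_erase hk)]

lemma DifferentiableAt.matrix_det {A : E → Matrix ι ι ℂ} {x : E}
    (hA : ∀ i j, DifferentiableAt ℝ (fun y => A y i j) x) :
    DifferentiableAt ℝ (fun y => (A y).det) x :=
  (HasFDerivAt.matrix_det fun i j => (hA i j).hasFDerivAt).differentiableAt

lemma DifferentiableAt.matrix_inv_apply {A : E → Matrix ι ι ℂ} {x : E}
    (hA : ∀ i j, DifferentiableAt ℝ (fun y => A y i j) x) (hdet : (A x).det ≠ 0) (i j : ι) :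
    DifferentiableAt ℝ (fun y => (A y)⁻¹ i j) x := by
  simp only [Matrix.inv_def, Matrix.smul_apply, smul_eq_mul, Ring.inverse_eq_inv',
    Matrix.adjugate_apply]
  refine ((DifferentiableAt.matrix_det hA).inv hdet).mul (DifferentiableAt.matrix_det fun k l => ?_)
  by_cases hk : k = j
  · simp [hk, Matrix.updateRow_self]
  · simpa [Matrix.updateRow_ne hk] using hA k l

lemma fderiv_matrix_inv_apply {A : E → Matrix ι ι ℂ} {x : E}
    (hA : ∀ i j, DifferentiableAt ℝ (fun y => A y i j) x) (hdet : (A x).det ≠ 0) (i j : ι) :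
    fderiv ℝ (fun y => (A y)⁻¹ i j) x =
      -∑ k, ∑ s, ((A x)⁻¹ i k * (A x)⁻¹ s j) • fderiv ℝ (fun y => A y k s) x := by
  have hP := DifferentiableAt.matrix_inv_apply hA hdet
  ext v
  let DA : Matrix ι ι ℂ := .of fun k s => fderiv ℝ (fun y => A y k s) x v
  let DP : Matrix ι ι ℂ := .of fun k s => fderiv ℝ (fun y => (A y)⁻¹ k s) x v
  have hmul : DP * A x + (A x)⁻¹ * DA = 0 := by
    ext k l
    have hev : (fun y => ∑ m, (A y)⁻¹ k m * A y m l) =ᶠ[nhds x]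
        fun _ => (1 : Matrix ι ι ℂ) k l := by
      filter_upwards [(DifferentiableAt.matrix_det hA).continuousAt.eventually_ne hdet] with y hy
      rw [← Matrix.mul_apply, Matrix.nonsing_inv_mul _ (isUnit_iff_ne_zero.2 hy)]
    have hd := HasFDerivAt.fun_sum (u := Finset.univ) fun m _ =>
      (hP k m).hasFDerivAt.mul (hA m l).hasFDerivAt
    have h0 := congrArg (fun L => L v) (hd.fderiv.symm.trans hev.fderiv_eq)
    simp only [fderiv_fun_const, sum_apply, add_apply,
      smul_apply, smul_eq_mul, Pi.zero_apply,
      zero_apply] at h0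
    rw [Matrix.add_apply, Matrix.mul_apply, Matrix.mul_apply, ← Finset.sum_add_distrib,
      Matrix.zero_apply, ← h0]
    refine Finset.sum_congr rfl fun m _ => ?_
    simp only [DA, DP, Matrix.of_apply]
    ring
  have hDP : DP = -((A x)⁻¹ * DA * (A x)⁻¹) := by
    rw [← Matrix.mul_nonsing_inv_cancel_right (A x) DP (isUnit_iff_ne_zero.2 hdet),
      eq_neg_of_add_eq_zero_left hmul, Matrix.neg_mul]
  have := congrFun (congrFun hDP i) j
  simp only [DP, Matrix.of_apply, Matrix.neg_apply, Matrix.mul_apply, Finset.sum_mul, DA] at this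
  rw [this, Finset.sum_comm]
  simp only [neg_apply, sum_apply,
    smul_apply, smul_eq_mul]
  congr 1
  refine Finset.sum_congr rfl fun k _ => Finset.sum_congr rfl fun s _ => ?_
  ring

end Jacobi

/-- **Equation (25).** With `Φ`, `g` as in equation (23) and `ψ` smooth satisfying the
fiberwise Monge–Ampère equation `log det g = Φ - ψ` on `Ω`,
`-Σ g^{j̄i} ∂²(∂²Φ/∂t∂t̄)/∂z^i∂z̄^j
   = -∂²Φ/∂t∂t̄ + ∂²ψ/∂t∂t̄ - Σ g^{s̄i} g^{j̄k} (∂g_{ks̄}/∂t)(∂g_{ij̄}/∂t̄)`. -/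
theorem equation25 (n : ℕ) (hn : 1 ≤ n) (Ω : Set (Etz n)) (hΩ : IsOpen Ω)
    (Φ : Etz n → ℝ) (hΦ : ContDiffOn ℝ (⊤ : ℕ∞) Φ Ω)
    (hpos : ∀ x ∈ Ω, (gmet Φ x).PosDef)
    (ψ : Etz n → ℝ) (hψ : ContDiffOn ℝ (⊤ : ℕ∞) ψ Ω)
    (hMA : ∀ x ∈ Ω, Real.log ((gmet Φ x).det.re) = Φ x - ψ x) :
    ∀ x ∈ Ω,
      -(∑ i, ∑ j, ginv Φ x j i *
          wD (wDbar (wD (wDbar (fun p => (Φ p : ℂ)) (dt n)) (dt n)) (dz n j)) (dz n i) x)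
        = -(wD (wDbar (fun p => (Φ p : ℂ)) (dt n)) (dt n) x)
          + wD (wDbar (fun p => (ψ p : ℂ)) (dt n)) (dt n) x
          - ∑ i, ∑ j, ∑ k, ∑ s, ginv Φ x s i * ginv Φ x j k *
              wD (fun y => gmet Φ y k s) (dt n) x * wDbar (fun y => gmet Φ y i j) (dt n) x := by
  have hΦc : ContDiffOn ℝ (⊤ : ℕ∞) (fun p => (Φ p : ℂ)) Ω :=
    Complex.ofRealCLM.contDiff.comp_contDiffOn hΦ
  have hψc : ContDiffOn ℝ (⊤ : ℕ∞) (fun p => (ψ p : ℂ)) Ω :=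
    Complex.ofRealCLM.contDiff.comp_contDiffOn hψ
  have hgmet (i j : Fin n) : (fun y => gmet Φ y i j) = fun y =>
      wirtinger (-Complex.I) (dz n i) (fderiv ℝ (fun z => wirtinger Complex.I (dz n j)
        (fderiv ℝ (fun p => (Φ p : ℂ)) z)) y) := by
    simp only [gmet, Matrix.of_apply, wD_eq_wirtinger, wDbar_eq_wirtinger]
  have hG (i j : Fin n) : ContDiffOn ℝ (⊤ : ℕ∞) (fun y => gmet Φ y i j) Ω := by
    rw [hgmet]
    exact (hΦc.wirtinger_fderiv hΩ _ _).wirtinger_fderiv hΩ _ _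
  have hGd {y : Etz n} (hy : y ∈ Ω) (i j : Fin n) :
      DifferentiableAt ℝ (fun y => gmet Φ y i j) y := (hG i j).differentiableAt_of_isOpen hΩ hy
  have hdet {y : Etz n} (hy : y ∈ Ω) : (gmet Φ y).det ≠ 0 := (hpos y hy).det_pos.ne'
  have hexp : Set.EqOn (fun y => (gmet Φ y).det)
      (fun y => Complex.exp ((Φ y : ℂ) - (ψ y : ℂ))) Ω := by
    intro y hy
    obtain ⟨hre, him⟩ := Complex.pos_iff.1 (hpos y hy).det_pos
    have h := Real.exp_log hre
    rw [hMA y hy] at h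
    apply Complex.ext
    · simp [← Complex.ofReal_sub, ← Complex.ofReal_exp, h]
    · simp [← Complex.ofReal_sub, ← Complex.ofReal_exp, ← him]
  have hfst : Set.EqOn
      (fun y => wirtinger Complex.I (dt n) (fderiv ℝ (fun p => (Φ p : ℂ)) y) -
        wirtinger Complex.I (dt n) (fderiv ℝ (fun p => (ψ p : ℂ)) y))
      (fun y => ∑ i, ∑ j, ginv Φ y j i *
        wirtinger Complex.I (dt n) (fderiv ℝ (fun z => gmet Φ z i j) y)) Ω := by
    intro y hy
    have h1 := wirtinger_fderiv_congr hΩ hexp Complex.I (dt n) hy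
    have hu := ((hΦc.differentiableAt_of_isOpen hΩ hy).hasFDerivAt.fun_sub
      (hψc.differentiableAt_of_isOpen hΩ hy).hasFDerivAt).cexp
    rw [(HasFDerivAt.matrix_det fun i j => (hGd hy i j).hasFDerivAt).fderiv,
      HasFDerivAt.fderiv hu, map_smul, map_sub] at h1
    rw [show Complex.exp ((Φ y : ℂ) - (ψ y : ℂ)) = (gmet Φ y).det from (hexp hy).symm,
      smul_eq_mul] at h1
    apply mul_left_cancel₀ (hdet hy)
    refine h1.symm.trans ?_
    simp only [map_sum, map_smul, smul_eq_mul, Finset.mul_sum, ginv, Matrix.inv_def,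
      Matrix.smul_apply, Ring.inverse_eq_inv']
    refine Finset.sum_congr rfl fun i _ => Finset.sum_congr rfl fun j _ => ?_
    rw [← mul_assoc, mul_inv_cancel_left₀ (hdet hy)]
  intro x hx
  have hinv (i j : Fin n) : wirtinger (-Complex.I) (dt n) (fderiv ℝ (fun y => ginv Φ y j i) x) =
      -∑ k, ∑ s, ginv Φ x j k * ginv Φ x s i *
        wirtinger (-Complex.I) (dt n) (fderiv ℝ (fun y => gmet Φ y k s) x) := by
    simp only [ginv, fderiv_matrix_inv_apply (hGd hx) (hdet hx), map_neg, map_sum, map_smul,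
      smul_eq_mul]
  have hswap (i j : Fin n) :
      wirtinger (-Complex.I) (dt n) (fderiv ℝ (fun y => wirtinger Complex.I (dt n)
        (fderiv ℝ (fun z => gmet Φ z i j) y)) x) =
      wirtinger (-Complex.I) (dz n i) (fderiv ℝ (fun y => wirtinger Complex.I (dz n j)
        (fderiv ℝ (fun y => wirtinger (-Complex.I) (dt n) (fderiv ℝ (fun y =>
          wirtinger Complex.I (dt n) (fderiv ℝ (fun p => (Φ p : ℂ)) y)) y)) y)) x) := by
    rw [hgmet]
    have hj := hΦc.wirtinger_fderiv hΩ Complex.I (dz n j)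
    have ht := hΦc.wirtinger_fderiv hΩ Complex.I (dt n)
    rw [wirtinger_fderiv_congr hΩ (fun y hy => wirtinger_fderiv_comm hΩ hj _ _ _ _ hy) _ _ hx,
      wirtinger_fderiv_comm hΩ (hj.wirtinger_fderiv hΩ _ _) _ _ _ _ hx]
    refine wirtinger_fderiv_congr hΩ (fun y hy => ?_) _ _ hx
    refine Eq.trans ?_ (wirtinger_fderiv_comm hΩ ht _ _ _ _ hy)
    exact wirtinger_fderiv_congr hΩ (fun z hz => wirtinger_fderiv_comm hΩ hΦc _ _ _ _ hz) _ _ hy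
  have hsnd := wirtinger_fderiv_congr hΩ hfst (-Complex.I) (dt n) hx
  have hl := ((hΦc.wirtinger_fderiv hΩ Complex.I (dt n)).differentiableAt_of_isOpen hΩ
    hx).hasFDerivAt.fun_sub ((hψc.wirtinger_fderiv hΩ Complex.I (dt n)).differentiableAt_of_isOpen
      hΩ hx).hasFDerivAt
  have hr := HasFDerivAt.fun_sum (u := Finset.univ) fun i _ =>
    HasFDerivAt.fun_sum (u := Finset.univ) fun j _ =>
      (show DifferentiableAt ℝ (fun y => ginv Φ y j i) x from
        DifferentiableAt.matrix_inv_apply (hGd hx) (hdet hx) j i).hasFDerivAt.fun_mul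
        (((hG i j).wirtinger_fderiv hΩ Complex.I (dt n)).differentiableAt_of_isOpen
          hΩ hx).hasFDerivAt
  rw [hl.fderiv, HasFDerivAt.fderiv hr] at hsnd
  simp only [map_sub, map_sum, map_add, map_smul, smul_eq_mul] at hsnd
  simp only [hinv, hswap] at hsnd
  simp only [wD_eq_wirtinger, wDbar_eq_wirtinger]
  rw [Finset.sum_congr rfl fun i _ => Finset.sum_add_distrib, Finset.sum_add_distrib] at hsnd
  have hquad : ∑ i, ∑ j, ∑ k, ∑ s, ginv Φ x s i * ginv Φ x j k *
        wirtinger (-Complex.I) (dt n) (fderiv ℝ (fun y => gmet Φ y k s) x) *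
        wirtinger Complex.I (dt n) (fderiv ℝ (fun y => gmet Φ y i j) x) =
      -∑ i, ∑ j, wirtinger Complex.I (dt n) (fderiv ℝ (fun y => gmet Φ y i j) x) *
        -∑ k, ∑ s, ginv Φ x j k * ginv Φ x s i *
          wirtinger (-Complex.I) (dt n) (fderiv ℝ (fun y => gmet Φ y k s) x) := by
    simp only [mul_neg, Finset.sum_neg_distrib, neg_neg, Finset.mul_sum]
    refine Finset.sum_congr rfl fun i _ => Finset.sum_congr rfl fun j _ =>
      Finset.sum_congr rfl fun k _ => Finset.sum_congr rfl fun s _ => ?_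
    ring
  rw [hquad]
  linear_combination hsnd

end
end

section
/- Let n ≥ 1 and let Ω be an open subset of ℂ × ℂⁿ with coordinates (t, z¹, …, zⁿ). Let Φ : Ω → ℝ be a C^∞ function; set g_{ij̄} := ∂²Φ/∂z^i∂z̄^j (1 ≤ i, j ≤ n) and assume that g := (g_{ij̄}) is positive definite at every point of Ω; let (g^{j̄i}) denote the entries of g⁻¹. Let ψ : Ω → ℝ be C^∞ with log det g = Φ − ψ on Ω, and define c := ∂²Φ/∂t∂t̄ − Σ_{i,j} g^{j̄i} (∂²Φ/∂t∂z̄^j)(∂²Φ/∂z^i∂t̄). Fix (t₀, z₀) ∈ Ω, assume the full (n+1)×(n+1) complex Hessian of ψ in the variables (t, z) is positive semidefinite at (t₀, z₀), and assume that the function z ↦ c(t₀, z) has a local minimum at z₀. Then c(t₀, z₀) ≥ 0. -/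
open Complex
open scoped ComplexOrder

noncomputable section

/-- The geodesic curvature
`c := ∂²Φ/∂t∂t̄ - Σ g^{j̄i} (∂²Φ/∂t∂z̄^j)(∂²Φ/∂z^i∂t̄)` (the Schur complement of eq. (13)). -/
def cgeo {n : ℕ} (Φ : Etz n → ℝ) (x : Etz n) : ℂ :=
  wD (wDbar (fun p => (Φ p : ℂ)) (dt n)) (dt n) x
    - ∑ i, ∑ j, ginv Φ x j i *
        wD (wDbar (fun p => (Φ p : ℂ)) (dz n j)) (dt n) x *
        wD (wDbar (fun p => (Φ p : ℂ)) (dt n)) (dz n i) x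

/-- The coordinate directions indexed by `{t, 1, …, n}`. -/
def dir (n : ℕ) : Option (Fin n) → Etz n
  | none => dt n
  | some i => dz n i

/-- The components of the horizontal lift `v` of `∂/∂t` (equation (32)):
`v^t := 1` and `v^i := -Σ_j g^{j̄i} ∂²Φ/∂t∂z̄^j`. -/
def vlift {n : ℕ} (Φ : Etz n → ℝ) : Option (Fin n) → Etz n → ℂ
  | none => fun _ => 1
  | some i => fun x =>
      -∑ j, ginv Φ x j i * wD (wDbar (fun p => (Φ p : ℂ)) (dz n j)) (dt n) x

/-- `|∂̄v|² := Σ g_{ik̄} g^{l̄j} (∂v^i/∂z̄^j) conj(∂v^k/∂z̄^l)`. -/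
def dbarv2 {n : ℕ} (Φ : Etz n → ℝ) (x : Etz n) : ℂ :=
  ∑ i, ∑ j, ∑ k, ∑ l, gmet Φ x i k * ginv Φ x l j *
    wDbar (vlift Φ (some i)) (dz n j) x *
    (starRingEnd ℂ) (wDbar (vlift Φ (some k)) (dz n l) x)

/-- `β(v, v̄) := Σ_{a,b ∈ {t,1,…,n}} (∂²ψ/∂a∂b̄) v^a conj(v^b)`. -/
def betav {n : ℕ} (Φ ψ : Etz n → ℝ) (x : Etz n) : ℂ :=
  ∑ a : Option (Fin n), ∑ b : Option (Fin n),
    wD (wDbar (fun p => (ψ p : ℂ)) (dir n b)) (dir n a) x *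
      vlift Φ a x * (starRingEnd ℂ) (vlift Φ b x)


section

open Filter Topology Matrix
open scoped ContDiff ComplexConjugate

section Wirtinger

variable {E : Type*} [NormedAddCommGroup E] [NormedSpace ℂ E]

/-- The common form of both Wirtinger derivatives: `s = -1` gives `wD` and `s = 1` gives `wDbar`. -/
def wirt (s : ℝ) (u : E → ℂ) (e : E) (x : E) : ℂ :=
  (1/2 : ℂ) * (fderiv ℝ u x e + s * Complex.I * fderiv ℝ u x (Complex.I • e))

theorem wD_eq_wirt (u : E → ℂ) (e : E) : wD u e = wirt (-1) u e := by
  funext x; simp [wD, wirt]; ring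

theorem wDbar_eq_wirt (u : E → ℂ) (e : E) : wDbar u e = wirt 1 u e := by
  funext x; simp [wDbar, wirt]

theorem wirt_congr {s : ℝ} {u v : E → ℂ} {e x : E} (h : u =ᶠ[𝓝 x] v) :
    wirt s u e x = wirt s v e x := by
  simp only [wirt, h.fderiv_eq]

theorem wirt_congr_on {Ω : Set E} (hΩ : IsOpen Ω) {s : ℝ} {u v : E → ℂ} {e x : E}
    (h : ∀ y ∈ Ω, u y = v y) (hx : x ∈ Ω) : wirt s u e x = wirt s v e x :=
  wirt_congr (Filter.mem_of_superset (hΩ.mem_nhds hx) h)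

theorem wirt_const (s : ℝ) (c : ℂ) (e x : E) : wirt s (fun _ => c) e x = 0 := by
  simp [wirt]

theorem wirt_add {s : ℝ} {u v : E → ℂ} {e x : E} (hu : DifferentiableAt ℝ u x)
    (hv : DifferentiableAt ℝ v x) :
    wirt s (fun y => u y + v y) e x = wirt s u e x + wirt s v e x := by
  simp only [wirt, fderiv_fun_add hu hv, _root_.add_apply]; ring

theorem wirt_sub {s : ℝ} {u v : E → ℂ} {e x : E} (hu : DifferentiableAt ℝ u x)
    (hv : DifferentiableAt ℝ v x) :
    wirt s (fun y => u y - v y) e x = wirt s u e x - wirt s v e x := by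
  simp only [wirt, fderiv_fun_sub hu hv, _root_.sub_apply]; ring

theorem wirt_sum {ι : Type*} (t : Finset ι) {s : ℝ} {u : ι → E → ℂ} {e x : E}
    (hu : ∀ i ∈ t, DifferentiableAt ℝ (u i) x) :
    wirt s (fun y => ∑ i ∈ t, u i y) e x = ∑ i ∈ t, wirt s (u i) e x := by
  simp only [wirt, fderiv_fun_sum hu, _root_.sum_apply, Finset.mul_sum,
    ← Finset.sum_add_distrib]

theorem wirt_mul {s : ℝ} {u v : E → ℂ} {e x : E} (hu : DifferentiableAt ℝ u x)
    (hv : DifferentiableAt ℝ v x) :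
    wirt s (fun y => u y * v y) e x = u x * wirt s v e x + wirt s u e x * v x := by
  simp only [wirt, fderiv_fun_mul hu hv, _root_.add_apply,
    _root_.smul_apply, smul_eq_mul]; ring

theorem wirt_const_mul {s : ℝ} {u : E → ℂ} {e x : E} (c : ℂ) (hu : DifferentiableAt ℝ u x) :
    wirt s (fun y => c * u y) e x = c * wirt s u e x := by
  rw [wirt_mul (differentiableAt_const c) hu, wirt_const]; ring

theorem wirt_cexp {s : ℝ} {u : E → ℂ} {e x : E} (hu : DifferentiableAt ℝ u x) :
    wirt s (fun y => Complex.exp (u y)) e x = Complex.exp (u x) * wirt s u e x := by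
  simp only [wirt, (hu.hasFDerivAt.cexp).fderiv, _root_.smul_apply, smul_eq_mul]; ring

theorem wirt_conj (s : ℝ) (u : E → ℂ) (e x : E) (hu : DifferentiableAt ℝ u x) :
    wirt s (fun y => conj (u y)) e x = conj (wirt (-s) u e x) := by
  have h : HasFDerivAt (fun y => conj (u y))
      ((Complex.conjCLE : ℂ →L[ℝ] ℂ).comp (fderiv ℝ u x)) x :=
    (Complex.conjCLE : ℂ →L[ℝ] ℂ).hasFDerivAt.comp x hu.hasFDerivAt
  simp only [wirt, h.fderiv]
  simp [map_ofNat]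

theorem wirt_add_dir (s : ℝ) (u : E → ℂ) (e f x : E) :
    wirt s u (e + f) x = wirt s u e x + wirt s u f x := by
  simp only [wirt, smul_add, map_add]; ring

theorem fderiv_complex_smul (u : E → ℂ) (c : ℂ) (e x : E) :
    fderiv ℝ u x (c • e) = c.re * fderiv ℝ u x e + c.im * fderiv ℝ u x (Complex.I • e) := by
  have h : c • e = c.re • e + c.im • (Complex.I • e) := by
    conv_lhs => rw [← Complex.re_add_im c, add_smul, mul_smul]
    simp
  rw [h, map_add, map_smul, map_smul]; simp

theorem wD_smul_dir (u : E → ℂ) (c : ℂ) (e x : E) :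
    wirt (-1) u (c • e) x = c * wirt (-1) u e x := by
  simp only [wirt, smul_smul, fderiv_complex_smul u c e x, fderiv_complex_smul u (Complex.I * c) e x]
  simp
  linear_combination (1/2*c.im * fderiv ℝ u x (Complex.I • e)) * Complex.I_mul_I +
    1/2 * (fderiv ℝ u x e - Complex.I * fderiv ℝ u x (Complex.I • e)) * Complex.re_add_im c

theorem wDbar_smul_dir (u : E → ℂ) (c : ℂ) (e x : E) :
    wirt 1 u (c • e) x = conj c * wirt 1 u e x := by
  simp only [wirt, smul_smul, fderiv_complex_smul u c e x, fderiv_complex_smul u (Complex.I * c) e x]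
  have hc : (c.re : ℂ) - c.im * Complex.I = conj c := by
    apply Complex.ext <;> simp
  simp
  linear_combination (1/2*c.im * fderiv ℝ u x (Complex.I • e)) * Complex.I_mul_I +
    1/2 * (fderiv ℝ u x e + Complex.I * fderiv ℝ u x (Complex.I • e)) * hc

theorem wirt_sum_dir {ι : Type*} (t : Finset ι) (s : ℝ) (u : E → ℂ) (e : ι → E) (x : E) :
    wirt s u (∑ i ∈ t, e i) x = ∑ i ∈ t, wirt s u (e i) x := by
  simp only [wirt, Finset.smul_sum, map_sum, Finset.mul_sum, ← Finset.sum_add_distrib]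

theorem contDiffOn_wirt {Ω : Set E} (hΩ : IsOpen Ω) {u : E → ℂ} (hu : ContDiffOn ℝ ∞ u Ω)
    (s : ℝ) (e : E) : ContDiffOn ℝ ∞ (wirt s u e) Ω := by
  have h : ContDiffOn ℝ ∞ (fderiv ℝ u) Ω := hu.fderiv_of_isOpen hΩ (by simp)
  unfold wirt
  exact contDiffOn_const.mul ((h.clm_apply contDiffOn_const).add
    (contDiffOn_const.mul (h.clm_apply contDiffOn_const)))

theorem ContDiffOn.diffAt {F : Type*} [NormedAddCommGroup F] [NormedSpace ℝ F]
    {Ω : Set E} (hΩ : IsOpen Ω) {u : E → F} (hu : ContDiffOn ℝ ∞ u Ω)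
    {x : E} (hx : x ∈ Ω) : DifferentiableAt ℝ u x :=
  (hu.contDiffAt (hΩ.mem_nhds hx)).differentiableAt (by simp)

theorem fderiv_wirt {Ω : Set E} (hΩ : IsOpen Ω) {u : E → ℂ} (hu : ContDiffOn ℝ ∞ u Ω)
    (s : ℝ) (e f x : E) (hx : x ∈ Ω) :
    fderiv ℝ (wirt s u e) x f = (1/2 : ℂ) * (fderiv ℝ (fderiv ℝ u) x f e
      + s * Complex.I * fderiv ℝ (fderiv ℝ u) x f (Complex.I • e)) := by
  have h : ContDiffOn ℝ ∞ (fderiv ℝ u) Ω := hu.fderiv_of_isOpen hΩ (by simp)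
  have hd := (h.diffAt hΩ hx).hasFDerivAt
  have h1 (v : E) := hd.clm_apply (hasFDerivAt_const v x)
  have := ((h1 e).add ((h1 (Complex.I • e)).const_mul (s * Complex.I))).const_mul (1/2 : ℂ)
  have h2 : HasFDerivAt (wirt s u e) _ x := this
  rw [h2.fderiv]; simp; ring

theorem wirt_comm {Ω : Set E} (hΩ : IsOpen Ω) {u : E → ℂ} (hu : ContDiffOn ℝ ∞ u Ω)
    (s r : ℝ) (e f x : E) (hx : x ∈ Ω) :
    wirt s (wirt r u f) e x = wirt r (wirt s u e) f x := by
  have hs : IsSymmSndFDerivAt ℝ u x := (hu.contDiffAt (hΩ.mem_nhds hx)).isSymmSndFDerivAt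
    (by rw [minSmoothness_of_isRCLikeNormedField]; exact WithTop.coe_le_coe.2 le_top)
  conv_lhs => rw [wirt]
  conv_rhs => rw [wirt]
  rw [fderiv_wirt hΩ hu _ _ _ _ hx, fderiv_wirt hΩ hu _ _ _ _ hx, fderiv_wirt hΩ hu _ _ _ _ hx,
    fderiv_wirt hΩ hu _ _ _ _ hx, hs e f, hs e (Complex.I • f), hs (Complex.I • e) f,
    hs (Complex.I • e) (Complex.I • f)]
  ring

theorem wirt_comp_line {Ω : Set E} (hΩ : IsOpen Ω) {u : E → ℂ} (hu : ContDiffOn ℝ ∞ u Ω)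
    (s : ℝ) (p e : E) (l : ℂ) (hl : p + l • e ∈ Ω) :
    wirt s (fun l : ℂ => u (p + l • e)) 1 l = wirt s u e (p + l • e) := by
  have h0 : HasFDerivAt (fun l : ℂ => p + l • e)
      ((ContinuousLinearMap.toSpanSingleton ℂ e).restrictScalars ℝ) l :=
    ((ContinuousLinearMap.toSpanSingleton ℂ e).restrictScalars ℝ).hasFDerivAt.const_add p
  have h1 : HasFDerivAt (fun l : ℂ => u (p + l • e)) _ l :=
    (hu.diffAt hΩ hl).hasFDerivAt.comp l h0
  simp [wirt, h1.fderiv]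

theorem second_deriv_nonneg_of_isLocalMin {f : ℝ → ℝ} {x : ℝ} (hf : ContinuousAt f x)
    (h : IsLocalMin f x) : 0 ≤ deriv (deriv f) x := by
  by_contra! hneg
  have hmax := isLocalMax_of_deriv_deriv_neg hneg h.deriv_eq_zero hf
  have hc : f =ᶠ[𝓝 x] fun _ => f x := by
    filter_upwards [h, hmax] with y h1 h2 using le_antisymm h2 h1
  have h2 : deriv f =ᶠ[𝓝 x] fun _ => 0 := by
    filter_upwards [hc.eventuallyEq_nhds] with y hy
    rw [hy.deriv_eq]; simp
  rw [h2.deriv_eq] at hneg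
  simp at hneg

theorem fderiv_fderiv_re_nonneg_of_isLocalMin {Ω : Set E} (hΩ : IsOpen Ω) {u : E → ℂ}
    (hu : ContDiffOn ℝ ∞ u Ω) {x : E} (hx : x ∈ Ω) (hmin : IsLocalMin (fun y => (u y).re) x)
    (e : E) : 0 ≤ (fderiv ℝ (fderiv ℝ u) x e e).re := by
  have hline (s : ℝ) : HasDerivAt (fun s : ℝ => x + s • e) e s := by
    simpa using ((hasDerivAt_id s).smul_const e).const_add x
  have hcont : Continuous (fun s : ℝ => x + s • e) := by fun_prop
  have hev : ∀ᶠ s : ℝ in 𝓝 0, x + s • e ∈ Ω :=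
    hcont.continuousAt.eventually (by simpa using hΩ.mem_nhds hx)
  have h1 : deriv (fun s : ℝ => (u (x + s • e)).re) =ᶠ[𝓝 0]
      fun s => (fderiv ℝ u (x + s • e) e).re := by
    filter_upwards [hev] with s hs
    exact (Complex.reCLM.hasFDerivAt.comp_hasDerivAt s
      ((hu.diffAt hΩ hs).hasFDerivAt.comp_hasDerivAt s (hline s))).deriv
  have h : ContDiffOn ℝ ∞ (fderiv ℝ u) Ω := hu.fderiv_of_isOpen hΩ (by simp)
  have h2 : HasDerivAt (fun s : ℝ => (fderiv ℝ u (x + s • e) e).re)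
      (fderiv ℝ (fderiv ℝ u) x e e).re 0 := by
    have h3 := (h.diffAt hΩ hx).hasFDerivAt.clm_apply (hasFDerivAt_const e x)
    have h4 : HasDerivAt (fun s : ℝ => fderiv ℝ u (x + s • e) e)
        (fderiv ℝ (fderiv ℝ u) x e e) 0 := by
      have hx0 : x = x + (0 : ℝ) • e := by simp
      rw [hx0] at h3
      have h5 := h3.comp_hasDerivAt (0 : ℝ) (hline 0)
      simp only [ContinuousLinearMap.comp_zero, zero_add] at h5
      rw [← hx0] at h5
      exact h5
    exact Complex.reCLM.hasFDerivAt.comp_hasDerivAt (0 : ℝ) h4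
  have h5 : IsLocalMin (fun s : ℝ => (u (x + s • e)).re) 0 := by
    have := hcont.continuousAt (x := (0 : ℝ))
    simp only [ContinuousAt, zero_smul, add_zero] at this
    have h6 := this.eventually hmin
    simpa [IsLocalMin, IsMinFilter] using h6
  have hc : ContinuousAt (fun s : ℝ => (u (x + s • e)).re) 0 := by
    have := ((hu.diffAt hΩ hx).continuousAt)
    have h7 : ContinuousAt u (x + (0:ℝ) • e) := by simpa using this
    exact Complex.continuous_re.continuousAt.comp
      (ContinuousAt.comp (f := fun s : ℝ => x + s • e) h7 hcont.continuousAt)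
  rw [← h2.deriv, ← h1.deriv_eq]
  exact second_deriv_nonneg_of_isLocalMin hc h5

/-- The complex second-derivative test along a complex line. -/
theorem wirt_wirt_re_nonneg_of_isLocalMin {Ω : Set E} (hΩ : IsOpen Ω) {u : E → ℂ}
    (hu : ContDiffOn ℝ ∞ u Ω) {x : E} (hx : x ∈ Ω) (hmin : IsLocalMin (fun y => (u y).re) x)
    (e : E) : 0 ≤ (wirt (-1) (wirt 1 u e) e x).re := by
  have hs : IsSymmSndFDerivAt ℝ u x := (hu.contDiffAt (hΩ.mem_nhds hx)).isSymmSndFDerivAt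
    (by rw [minSmoothness_of_isRCLikeNormedField]; exact WithTop.coe_le_coe.2 le_top)
  have h1 := fderiv_fderiv_re_nonneg_of_isLocalMin hΩ hu hx hmin e
  have h2 := fderiv_fderiv_re_nonneg_of_isLocalMin hΩ hu hx hmin (Complex.I • e)
  have h3 : wirt (-1) (wirt 1 u e) e x = ((1/4 : ℝ) : ℂ) * (fderiv ℝ (fderiv ℝ u) x e e +
      fderiv ℝ (fderiv ℝ u) x (Complex.I • e) (Complex.I • e)) := by
    rw [wirt, fderiv_wirt hΩ hu _ _ _ _ hx, fderiv_wirt hΩ hu _ _ _ _ hx, hs e (Complex.I • e)]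
    push_cast
    linear_combination (-(1/4) * fderiv ℝ (fderiv ℝ u) x (Complex.I • e) (Complex.I • e)) *
      Complex.I_mul_I
  rw [h3, Complex.re_ofReal_mul, Complex.add_re]
  positivity

end Wirtinger

section Determinant

variable {E : Type*} [NormedAddCommGroup E] [NormedSpace ℂ E]
variable {ι : Type*} [Fintype ι] [DecidableEq ι]

/-- Jacobi's formula for the differential of a determinant. -/
theorem hasFDerivAt_det {M : E → Matrix ι ι ℂ} {M' : ι → ι → E →L[ℝ] ℂ} {x : E}
    (hM : ∀ i j, HasFDerivAt (fun y => M y i j) (M' i j) x) :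
    HasFDerivAt (fun y => (M y).det)
      (∑ i, ∑ j, (M x).adjugate i j • M' j i) x := by
  have h : HasFDerivAt (fun y => (M y).det) (∑ σ : Equiv.Perm ι, ((Equiv.Perm.sign σ : ℤ) : ℂ) •
      ∑ i, (∏ j ∈ Finset.univ.erase i, M x (σ j) j) • M' (σ i) i) x := by
    simp only [Matrix.det_apply']
    exact HasFDerivAt.fun_sum fun σ _ =>
      (HasFDerivAt.finsetProd (u := Finset.univ) fun i _ => hM (σ i) i).const_mul _
  convert h using 1
  ext v
  have h1 (i : ι) : ∑ j, (M x).adjugate i j * M' j i v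
      = ((M x).updateCol i (fun j => M' j i v)).det := by
    rw [← Matrix.cramer_apply, Matrix.cramer_eq_adjugate_mulVec]; rfl
  simp only [_root_.sum_apply, _root_.smul_apply, smul_eq_mul, h1, Matrix.det_apply',
    Finset.mul_sum]
  rw [Finset.sum_comm]
  refine Finset.sum_congr rfl fun σ _ => Finset.sum_congr rfl fun i _ => ?_
  rw [← Finset.mul_prod_erase _ _ (Finset.mem_univ i), Matrix.updateCol_self,
    Finset.prod_congr rfl fun j hj => Matrix.updateCol_ne (Finset.ne_of_mem_erase hj)]
  ring

theorem wirt_det {M : E → Matrix ι ι ℂ} {s : ℝ} {e x : E}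
    (hM : ∀ i j, DifferentiableAt ℝ (fun y => M y i j) x) :
    wirt s (fun y => (M y).det) e x
      = ∑ i, ∑ j, (M x).adjugate i j * wirt s (fun y => M y j i) e x := by
  simp only [wirt, (hasFDerivAt_det fun i j => (hM i j).hasFDerivAt).fderiv, _root_.sum_apply,
    _root_.smul_apply, smul_eq_mul, Finset.mul_sum, ← Finset.sum_add_distrib]
  refine Finset.sum_congr rfl fun i _ => Finset.sum_congr rfl fun j _ => ?_
  ring

theorem contDiffOn_det {Ω : Set E} {M : E → Matrix ι ι ℂ}
    (hM : ∀ i j, ContDiffOn ℝ ∞ (fun y => M y i j) Ω) :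
    ContDiffOn ℝ ∞ (fun y => (M y).det) Ω := by
  simp only [Matrix.det_apply']
  exact ContDiffOn.sum fun σ _ => contDiffOn_const.mul (contDiffOn_prod fun i _ => hM _ _)

theorem contDiffOn_adjugate {Ω : Set E} {M : E → Matrix ι ι ℂ}
    (hM : ∀ i j, ContDiffOn ℝ ∞ (fun y => M y i j) Ω) (i j : ι) :
    ContDiffOn ℝ ∞ (fun y => (M y).adjugate i j) Ω := by
  simp only [Matrix.adjugate_apply]
  refine contDiffOn_det fun k l => ?_
  by_cases h : k = j
  · subst h; simpa using contDiffOn_const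
  · simpa [Matrix.updateRow_ne h] using hM k l

theorem contDiffOn_inv_apply {Ω : Set E} {M : E → Matrix ι ι ℂ}
    (hM : ∀ i j, ContDiffOn ℝ ∞ (fun y => M y i j) Ω) (hdet : ∀ y ∈ Ω, (M y).det ≠ 0) (i j : ι) :
    ContDiffOn ℝ ∞ (fun y => (M y)⁻¹ i j) Ω := by
  simp only [Matrix.inv_def, Ring.inverse_eq_inv', Matrix.smul_apply, smul_eq_mul]
  exact ((contDiffOn_det hM).inv hdet).mul (contDiffOn_adjugate hM i j)

/-- The complex Hessian of `log det G` at a point where `G` is the identity. -/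
theorem wirt_wirt_of_det_eq_exp {Ω : Set E} (hΩ : IsOpen Ω) {G : E → Matrix ι ι ℂ}
    (hG : ∀ i j, ContDiffOn ℝ ∞ (fun y => G y i j) Ω) {F : E → ℂ} (hF : ContDiffOn ℝ ∞ F Ω)
    {κ : ℂ} (hκ : κ ≠ 0) (hdet : ∀ y ∈ Ω, (G y).det = κ * Complex.exp (F y))
    {x : E} (hx : x ∈ Ω) (hG1 : G x = 1) (e : E) :
    wirt (-1) (wirt 1 F e) e x = ∑ i, wirt (-1) (wirt 1 (fun y => G y i i) e) e x
      - ∑ i, ∑ j, wirt (-1) (fun y => G y i j) e x * wirt 1 (fun y => G y j i) e x := by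
  have hdet0 : ∀ y ∈ Ω, (G y).det ≠ 0 := fun y hy => by
    rw [hdet y hy]; exact mul_ne_zero hκ (Complex.exp_ne_zero _)
  have hN := contDiffOn_inv_apply hG hdet0
  have h1 : ∀ y ∈ Ω, wirt 1 F e y = ∑ i, ∑ j, (G y)⁻¹ i j * wirt 1 (fun y => G y j i) e y := by
    intro y hy
    have h2 := wirt_det (s := 1) (e := e) fun i j => (hG i j).diffAt hΩ hy
    rw [wirt_congr_on hΩ hdet hy, wirt_const_mul _ ((hF.cexp).diffAt hΩ hy),
      wirt_cexp (hF.diffAt hΩ hy), ← mul_assoc, ← hdet y hy] at h2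
    rw [← mul_right_inj' (hdet0 y hy), h2, Finset.mul_sum]
    refine Finset.sum_congr rfl fun i _ => ?_
    rw [Finset.mul_sum]
    refine Finset.sum_congr rfl fun j _ => ?_
    rw [Matrix.inv_def, Ring.inverse_eq_inv', Matrix.smul_apply, smul_eq_mul]
    field_simp [hdet0 y hy]
  have hNd (i j : ι) : wirt (-1) (fun y => (G y)⁻¹ i j) e x
      = - wirt (-1) (fun y => G y i j) e x := by
    have h3 : wirt (-1) (fun y => ∑ k, (G y)⁻¹ i k * G y k j) e x = 0 := by
      rw [← wirt_const (-1) ((1 : Matrix ι ι ℂ) i j) e x]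
      refine wirt_congr_on hΩ (fun y hy => ?_) hx
      rw [← Matrix.mul_apply, Matrix.nonsing_inv_mul _ (isUnit_iff_ne_zero.2 (hdet0 y hy))]
    rw [wirt_sum _ fun k _ => ((hN i k).mul (hG k j)).diffAt hΩ hx] at h3
    simp_rw [wirt_mul ((hN _ _).diffAt hΩ hx) ((hG _ _).diffAt hΩ hx)] at h3
    simp only [hG1, inv_one, Matrix.one_apply, ite_mul, one_mul, zero_mul, mul_ite, mul_one,
      mul_zero, Finset.sum_add_distrib, Finset.sum_ite_eq, Finset.sum_ite_eq', Finset.mem_univ,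
      if_true] at h3
    linear_combination h3
  have hW (i j : ι) := contDiffOn_wirt hΩ (hG i j) 1 e
  rw [wirt_congr_on hΩ h1 hx, wirt_sum _ fun i _ =>
    (ContDiffOn.sum fun j _ => (hN i j).mul (hW j i)).diffAt hΩ hx, ← Finset.sum_sub_distrib]
  refine Finset.sum_congr rfl fun i _ => ?_
  rw [wirt_sum _ fun j _ => ((hN i j).mul (hW j i)).diffAt hΩ hx]
  simp_rw [wirt_mul ((hN _ _).diffAt hΩ hx) ((hW _ _).diffAt hΩ hx), hNd]
  simp [hG1, Matrix.one_apply, Finset.sum_add_distrib, sub_eq_add_neg]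

end Determinant

section ComplexHessian

variable {E : Type*} [NormedAddCommGroup E] [NormedSpace ℂ E]

/-- The complex Hessian `∂_e ∂̄_f u`. -/
def hess (u : E → ℂ) (e f x : E) : ℂ := wirt (-1) (wirt 1 u f) e x

theorem wD_wDbar_eq_hess (u : E → ℂ) (e f x : E) : wD (wDbar u f) e x = hess u e f x := by
  rw [wD_eq_wirt, wDbar_eq_wirt, hess]

variable {Ω : Set E} {u : E → ℂ}

theorem contDiffOn_hess (hΩ : IsOpen Ω) (hu : ContDiffOn ℝ ∞ u Ω) (e f : E) :
    ContDiffOn ℝ ∞ (hess u e f) Ω :=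
  contDiffOn_wirt hΩ (contDiffOn_wirt hΩ hu 1 f) (-1) e

theorem hess_add_left (u : E → ℂ) (e e' f x : E) :
    hess u (e + e') f x = hess u e f x + hess u e' f x := wirt_add_dir _ _ _ _ _

theorem hess_add_right (hΩ : IsOpen Ω) (hu : ContDiffOn ℝ ∞ u Ω) (e f f' : E) {x : E}
    (hx : x ∈ Ω) : hess u e (f + f') x = hess u e f x + hess u e f' x := by
  have h : wirt 1 u (f + f') = fun y => wirt 1 u f y + wirt 1 u f' y :=
    funext fun y => wirt_add_dir _ _ _ _ _
  rw [hess, h, wirt_add ((contDiffOn_wirt hΩ hu 1 f).diffAt hΩ hx)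
    ((contDiffOn_wirt hΩ hu 1 f').diffAt hΩ hx), hess, hess]

theorem hess_smul_left (u : E → ℂ) (c : ℂ) (e f x : E) :
    hess u (c • e) f x = c * hess u e f x := wD_smul_dir _ _ _ _

theorem hess_smul_right (hΩ : IsOpen Ω) (hu : ContDiffOn ℝ ∞ u Ω) (c : ℂ) (e f : E) {x : E}
    (hx : x ∈ Ω) : hess u e (c • f) x = conj c * hess u e f x := by
  have h : wirt 1 u (c • f) = fun y => conj c * wirt 1 u f y :=
    funext fun y => wDbar_smul_dir _ _ _ _
  rw [hess, h, wirt_const_mul _ ((contDiffOn_wirt hΩ hu 1 f).diffAt hΩ hx), hess]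

theorem hess_sum_left {ι : Type*} (t : Finset ι) (u : E → ℂ) (a : ι → ℂ) (e : ι → E) (f x : E) :
    hess u (∑ i ∈ t, a i • e i) f x = ∑ i ∈ t, a i * hess u (e i) f x := by
  rw [hess, wirt_sum_dir]
  exact Finset.sum_congr rfl fun i _ => wD_smul_dir _ _ _ _

theorem hess_sum_right (hΩ : IsOpen Ω) (hu : ContDiffOn ℝ ∞ u Ω) {ι : Type*} (t : Finset ι)
    (a : ι → ℂ) (e : E) (f : ι → E) {x : E} (hx : x ∈ Ω) :
    hess u e (∑ i ∈ t, a i • f i) x = ∑ i ∈ t, conj (a i) * hess u e (f i) x := by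
  have h : wirt 1 u (∑ i ∈ t, a i • f i) = fun y => ∑ i ∈ t, wirt 1 u (a i • f i) y :=
    funext fun y => wirt_sum_dir _ _ _ _ _
  rw [hess, h, wirt_sum _ fun i _ => (contDiffOn_wirt hΩ hu 1 _).diffAt hΩ hx]
  exact Finset.sum_congr rfl fun i _ => hess_smul_right hΩ hu _ _ _ hx

theorem wirt_conj_of_real (hΩ : IsOpen Ω) (hu : ContDiffOn ℝ ∞ u Ω) (hr : ∀ y, conj (u y) = u y)
    (s : ℝ) (e : E) {x : E} (hx : x ∈ Ω) : conj (wirt s u e x) = wirt (-s) u e x := by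
  have h := wirt_conj (-s) u e x (hu.diffAt hΩ hx)
  rw [neg_neg] at h
  rw [← h]
  simp only [hr]

theorem hess_conj (hΩ : IsOpen Ω) (hu : ContDiffOn ℝ ∞ u Ω) (hr : ∀ y, conj (u y) = u y)
    (e f : E) {x : E} (hx : x ∈ Ω) : conj (hess u e f x) = hess u f e x := by
  have h := wirt_conj 1 (wirt 1 u f) e x ((contDiffOn_wirt hΩ hu 1 f).diffAt hΩ hx)
  rw [hess, ← h, hess, wirt_comm hΩ hu _ _ _ _ _ hx]
  exact wirt_congr_on hΩ (fun y hy => wirt_conj_of_real hΩ hu hr 1 f hy) hx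

theorem hess_hess_comm (hΩ : IsOpen Ω) (hu : ContDiffOn ℝ ∞ u Ω) (e f : E) {x : E} (hx : x ∈ Ω) :
    hess (hess u f f) e e x = hess (hess u e e) f f x := by
  have hs (s : ℝ) (g : E) := contDiffOn_wirt hΩ hu s g
  have h1 : ∀ y ∈ Ω, wirt 1 (hess u f f) e y = wirt (-1) (wirt 1 (wirt 1 u e) f) f y := by
    intro y hy
    rw [show hess u f f = wirt (-1) (wirt 1 u f) f from rfl, wirt_comm hΩ (hs 1 f) _ _ _ _ _ hy]
    exact wirt_congr_on hΩ (fun z hz => wirt_comm hΩ hu _ _ _ _ _ hz) hy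
  rw [hess, wirt_congr_on hΩ h1 hx, wirt_comm hΩ (contDiffOn_wirt hΩ (hs 1 e) 1 f) _ _ _ _ _ hx]
  exact wirt_congr_on hΩ (fun z hz => wirt_comm hΩ (hs 1 e) _ _ _ _ _ hz) hx

theorem wirt_id (s : ℝ) (l : ℂ) : wirt s (fun l : ℂ => l) 1 l = (1 - s) / 2 := by
  simp [wirt]
  linear_combination (1/2 * (s : ℂ)) * Complex.I_mul_I

theorem wirt_conj_id (s : ℝ) (l : ℂ) : wirt s (fun l : ℂ => conj l) 1 l = (1 + s) / 2 := by
  rw [wirt_conj _ _ _ _ differentiableAt_fun_id, wirt_id]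
  simp [map_ofNat]

/-- The Laplacian at `0` of a quadratic polynomial in `l`, `conj l` with variable coefficients. -/
theorem hess_quadratic_zero {D : Set ℂ} (hD : IsOpen D) (h0 : (0 : ℂ) ∈ D) {U V W Z : ℂ → ℂ}
    (hU : ContDiffOn ℝ ∞ U D) (hV : ContDiffOn ℝ ∞ V D) (hW : ContDiffOn ℝ ∞ W D)
    (hZ : ContDiffOn ℝ ∞ Z D) :
    hess (fun l => U l + l * V l + conj l * W l + l * (conj l * Z l)) 1 1 0
      = hess U 1 1 0 + wirt 1 V 1 0 + wirt (-1) W 1 0 + Z 0 := by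
  have hid (l : ℂ) : DifferentiableAt ℝ (fun l : ℂ => l) l := differentiableAt_fun_id
  have hcj (l : ℂ) : DifferentiableAt ℝ (fun l : ℂ => conj l) l :=
    (Complex.conjCLE : ℂ →L[ℝ] ℂ).differentiableAt
  have h1 : ∀ l ∈ D, wirt 1 (fun l => U l + l * V l + conj l * W l + l * (conj l * Z l)) 1 l
      = wirt 1 U 1 l + l * wirt 1 V 1 l + (conj l * wirt 1 W 1 l + W l)
        + l * (conj l * wirt 1 Z 1 l + Z l) := by
    intro l hl
    have dU := hU.diffAt hD hl
    have dV := hV.diffAt hD hl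
    have dW := hW.diffAt hD hl
    have dZ := hZ.diffAt hD hl
    rw [wirt_add ((dU.fun_add ((hid l).fun_mul dV)).fun_add ((hcj l).fun_mul dW))
        ((hid l).fun_mul ((hcj l).fun_mul dZ)),
      wirt_add (dU.fun_add ((hid l).fun_mul dV)) ((hcj l).fun_mul dW),
      wirt_add dU ((hid l).fun_mul dV), wirt_mul (hid l) dV, wirt_mul (hcj l) dW,
      wirt_mul (hid l) ((hcj l).fun_mul dZ), wirt_mul (hcj l) dZ, wirt_id, wirt_conj_id]
    push_cast
    ring
  have dU := (contDiffOn_wirt hD hU 1 1).diffAt hD h0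
  have dV := (contDiffOn_wirt hD hV 1 1).diffAt hD h0
  have dW := (contDiffOn_wirt hD hW 1 1).diffAt hD h0
  have dZ := (contDiffOn_wirt hD hZ 1 1).diffAt hD h0
  have dW0 := hW.diffAt hD h0
  have dZ0 := hZ.diffAt hD h0
  rw [hess, wirt_congr_on hD h1 h0,
    wirt_add ((dU.fun_add ((hid 0).fun_mul dV)).fun_add (((hcj 0).fun_mul dW).fun_add dW0))
      ((hid 0).fun_mul (((hcj 0).fun_mul dZ).fun_add dZ0)),
    wirt_add (dU.fun_add ((hid 0).fun_mul dV)) (((hcj 0).fun_mul dW).fun_add dW0),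
    wirt_add dU ((hid 0).fun_mul dV), wirt_add ((hcj 0).fun_mul dW) dW0,
    wirt_mul (hid 0) dV, wirt_mul (hcj 0) dW,
    wirt_mul (hid 0) (((hcj 0).fun_mul dZ).fun_add dZ0), wirt_id, wirt_conj_id]
  simp [hess]

theorem isOpen_line_preimage (hΩ : IsOpen Ω) (x f : E) : IsOpen {l : ℂ | x + l • f ∈ Ω} :=
  hΩ.preimage (by fun_prop)

theorem contDiffOn_comp_line {v : E → ℂ} (hv : ContDiffOn ℝ ∞ v Ω) (x f : E) :
    ContDiffOn ℝ ∞ (fun l : ℂ => v (x + l • f)) {l : ℂ | x + l • f ∈ Ω} :=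
  hv.comp (by fun_prop) fun _ hl => hl

theorem hess_linear_expand (hΩ : IsOpen Ω) (hu : ContDiffOn ℝ ∞ u Ω) (e a : E) (l : ℂ) {y : E}
    (hy : y ∈ Ω) : hess u (e + l • a) (e + l • a) y
      = hess u e e y + l * hess u a e y + conj l * hess u e a y
        + l * (conj l * hess u a a y) := by
  rw [hess_add_left, hess_add_right hΩ hu _ _ _ hy, hess_add_right hΩ hu _ _ _ hy,
    hess_smul_left, hess_smul_left, hess_smul_right hΩ hu _ _ _ hy,
    hess_smul_right hΩ hu _ _ _ hy]
  ring

/-- If the Hessian in a direction varying linearly along a complex line has a local minimum, then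
its Laplacian there is nonnegative. -/
theorem hess_line_re_nonneg (hΩ : IsOpen Ω) (hu : ContDiffOn ℝ ∞ u Ω) {x : E} (hx : x ∈ Ω)
    (e a f : E)
    (hmin : IsLocalMin (fun l : ℂ => (hess u (e + l • a) (e + l • a) (x + l • f)).re) 0) :
    0 ≤ (hess (hess u e e) f f x + wirt 1 (hess u a e) f x + wirt (-1) (hess u e a) f x
      + hess u a a x).re := by
  have hD := isOpen_line_preimage hΩ x f
  set D := {l : ℂ | x + l • f ∈ Ω}
  have h0 : (0 : ℂ) ∈ D := by simpa [D] using hx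
  have hc (e f' : E) := contDiffOn_comp_line (contDiffOn_hess hΩ hu e f') x f
  have hq : ∀ l ∈ D, hess u (e + l • a) (e + l • a) (x + l • f)
      = hess u e e (x + l • f) + l * hess u a e (x + l • f) + conj l * hess u e a (x + l • f)
        + l * (conj l * hess u a a (x + l • f)) := fun l hl => hess_linear_expand hΩ hu e a l hl
  have hconj : ContDiffOn ℝ ∞ (fun l : ℂ => conj l) D :=
    (Complex.conjCLE : ℂ →L[ℝ] ℂ).contDiff.contDiffOn
  have hqs : ContDiffOn ℝ ∞ (fun l : ℂ => hess u (e + l • a) (e + l • a) (x + l • f)) D :=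
    ContDiffOn.congr ((((hc e e).add (contDiffOn_id.mul (hc a e))).add
      (hconj.mul (hc e a))).add (contDiffOn_id.mul (hconj.mul (hc a a)))) hq
  have h1 := wirt_wirt_re_nonneg_of_isLocalMin hD hqs h0 hmin 1
  have h2 : wirt (-1) (wirt 1 (fun l : ℂ => hess u (e + l • a) (e + l • a) (x + l • f)) 1) 1 0
      = _ := (wirt_congr_on hD (fun l hl => wirt_congr_on hD hq hl) h0).trans
        (hess_quadratic_zero hD h0 (hc e e) (hc a e) (hc e a) (hc a a))
  rw [h2] at h1
  have hl (s : ℝ) {v : E → ℂ} (hv : ContDiffOn ℝ ∞ v Ω) :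
      wirt s (fun l : ℂ => v (x + l • f)) 1 0 = wirt s v f x := by
    rw [wirt_comp_line hΩ hv s x f 0 h0]; simp
  have hh := contDiffOn_hess hΩ hu
  have h3 : hess (fun l : ℂ => hess u e e (x + l • f)) 1 1 0 = hess (hess u e e) f f x := by
    rw [hess, wirt_congr_on hD (fun l hl => wirt_comp_line hΩ (hh e e) 1 x f l hl) h0]
    exact hl _ (contDiffOn_wirt hΩ (hh e e) 1 f)
  rw [h3, hl _ (hh a e), hl _ (hh e a)] at h1
  simpa using h1

variable {ι : Type*} [Fintype ι] [DecidableEq ι]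

/-- The maximum principle behind the positivity of the geodesic curvature, in a frame `f` which is
unitary for the complex Hessian of `u` at `x`. -/
theorem hess_re_nonneg_of_isLocalMin (hΩ : IsOpen Ω) (hu : ContDiffOn ℝ ∞ u Ω)
    (hr : ∀ y, conj (u y) = u y) {F : E → ℂ} (hF : ContDiffOn ℝ ∞ F Ω) (f : ι → E)
    {κ : ℂ} (hκ : κ ≠ 0)
    (hdet : ∀ y ∈ Ω, (Matrix.of fun i j => hess u (f i) (f j) y).det = κ * Complex.exp (F y))
    {x : E} (hx : x ∈ Ω) (hG1 : (Matrix.of fun i j => hess u (f i) (f j) x) = 1) (e : E)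
    (hmin : ∀ (k : ι) (α : ι → ℂ), IsLocalMin (fun l : ℂ =>
      (hess u (e + l • ∑ i, α i • f i) (e + l • ∑ i, α i • f i) (x + l • f k)).re) 0) :
    0 ≤ (hess F e e x).re := by
  have hh := contDiffOn_hess hΩ hu
  set b : ι → ι → ℂ := fun k l => wirt (-1) (hess u (f k) (f l)) e x with hb
  have hbc (k l : ι) : wirt 1 (hess u (f l) (f k)) e x = conj (b k l) := by
    have := wirt_conj 1 (hess u (f k) (f l)) e x ((hh _ _).diffAt hΩ hx)
    rw [hb, ← this]
    exact (wirt_congr_on hΩ (fun y hy => hess_conj hΩ hu hr _ _ hy) hx).symm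
  have hb1 (k l : ι) : wirt (-1) (hess u e (f l)) (f k) x = b k l :=
    wirt_comm hΩ (contDiffOn_wirt hΩ hu 1 (f l)) _ _ _ _ _ hx
  have hb2 (k l : ι) : wirt 1 (hess u (f l) e) (f k) x = conj (b k l) := by
    rw [← hb1]
    have := wirt_conj 1 (hess u e (f l)) (f k) x ((hh _ _).diffAt hΩ hx)
    rw [← this]
    exact (wirt_congr_on hΩ (fun y hy => hess_conj hΩ hu hr _ _ hy) hx).symm
  have hone (k l : ι) : hess u (f k) (f l) x = if k = l then 1 else 0 := by
    have := congrFun (congrFun hG1 k) l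
    simpa [Matrix.one_apply] using this
  have key (k : ι) : 0 ≤ (hess (hess u (f k) (f k)) e e x - ∑ l, b k l * conj (b k l)).re := by
    have h := hess_line_re_nonneg hΩ hu hx e _ (f k) (hmin k fun l => -b k l)
    have h1 : wirt 1 (hess u (∑ l, -b k l • f l) e) (f k) x = -∑ l, b k l * conj (b k l) := by
      rw [show hess u (∑ l, -b k l • f l) e = fun y => ∑ l, -b k l * hess u (f l) e y from
        funext fun y => hess_sum_left _ _ _ _ _ _, wirt_sum _ fun l _ =>
          (contDiffOn_const.mul (hh _ _)).diffAt hΩ hx]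
      simp_rw [wirt_const_mul _ ((hh _ _).diffAt hΩ hx), hb2]
      simp
    have h2 : wirt (-1) (hess u e (∑ l, -b k l • f l)) (f k) x
        = -∑ l, b k l * conj (b k l) := by
      rw [wirt_congr_on hΩ (fun y hy => hess_sum_right hΩ hu _ _ _ _ hy) hx, wirt_sum _ fun l _ =>
          (contDiffOn_const.mul (hh _ _)).diffAt hΩ hx]
      simp_rw [wirt_const_mul _ ((hh _ _).diffAt hΩ hx), hb1]
      simp [mul_comm]
    have h3 : hess u (∑ l, -b k l • f l) (∑ l, -b k l • f l) x = ∑ l, b k l * conj (b k l) := by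
      rw [hess_sum_left]
      simp_rw [hess_sum_right hΩ hu _ _ _ _ hx, hone]
      simp
    rw [h1, h2, h3] at h
    rw [hess_hess_comm hΩ hu _ _ hx]
    convert h using 2
    ring
  have hA := wirt_wirt_of_det_eq_exp hΩ (G := fun y => Matrix.of fun i j => hess u (f i) (f j) y)
    (fun i j => hh (f i) (f j)) hF hκ hdet hx hG1 e
  have hA' : hess F e e x = ∑ k, (hess (hess u (f k) (f k)) e e x - ∑ l, b k l * conj (b k l)) := by
    rw [Finset.sum_sub_distrib]
    simp_rw [← hbc]
    exact hA
  rw [hA', Complex.re_sum]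
  exact Finset.sum_nonneg fun k _ => key k

end ComplexHessian

section GeodesicCurvature

variable {n : ℕ} {Ω : Set (Etz n)} {Φ : Etz n → ℝ}

/-- The vector `∂/∂t + Σ w^i ∂/∂z^i`. -/
def horiz (n : ℕ) (w : Fin n → ℂ) : Etz n := dt n + ∑ i, w i • dz n i

theorem horiz_add_smul (w α : Fin n → ℂ) (l : ℂ) :
    horiz n w + l • ∑ i, α i • dz n i = horiz n (w + l • α) := by
  simp [horiz, add_smul, Finset.sum_add_distrib, Finset.smul_sum, mul_smul, add_assoc]

theorem contDiffOn_ofReal_comp (hΦ : ContDiffOn ℝ ∞ Φ Ω) :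
    ContDiffOn ℝ ∞ (fun p => (Φ p : ℂ)) Ω :=
  Complex.ofRealCLM.contDiff.comp_contDiffOn hΦ

theorem gmet_apply (Φ : Etz n → ℝ) (x : Etz n) (i j : Fin n) :
    gmet Φ x i j = hess (fun p => (Φ p : ℂ)) (dz n i) (dz n j) x := wD_wDbar_eq_hess _ _ _ _

theorem hess_horiz (hΩ : IsOpen Ω) (hΦ : ContDiffOn ℝ ∞ Φ Ω) (w : Fin n → ℂ) {x : Etz n}
    (hx : x ∈ Ω) : hess (fun p => (Φ p : ℂ)) (horiz n w) (horiz n w) x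
      = hess (fun p => (Φ p : ℂ)) (dt n) (dt n) x
        + (w ⬝ᵥ fun i => hess (fun p => (Φ p : ℂ)) (dz n i) (dt n) x)
        + (fun i => hess (fun p => (Φ p : ℂ)) (dt n) (dz n i) x) ⬝ᵥ star w
        + w ⬝ᵥ (gmet Φ x *ᵥ star w) := by
  have hu := contDiffOn_ofReal_comp hΦ
  rw [horiz, hess_add_left, hess_add_right hΩ hu _ _ _ hx, hess_add_right hΩ hu _ _ _ hx,
    hess_sum_left, hess_sum_right hΩ hu _ _ _ _ hx, hess_sum_left]
  simp_rw [hess_sum_right hΩ hu _ _ _ _ hx]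
  simp only [dotProduct, Matrix.mulVec, gmet_apply, Pi.star_apply, RCLike.star_def]
  simp only [mul_comm]
  ring

/-- Completing the square: the geodesic curvature is the minimum of the complex Hessian over all
lifts of `∂/∂t`, attained at the horizontal lift. -/
theorem hess_horiz_eq_cgeo_add (hΩ : IsOpen Ω) (hΦ : ContDiffOn ℝ ∞ Φ Ω) (w : Fin n → ℂ)
    {x : Etz n} (hx : x ∈ Ω) (hpos : (gmet Φ x).PosDef) :
    hess (fun p => (Φ p : ℂ)) (horiz n w) (horiz n w) x
      = cgeo Φ x + (w - fun i => vlift Φ (some i) x) ⬝ᵥ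
          (gmet Φ x *ᵥ star (w - fun i => vlift Φ (some i) x)) := by
  have hu := contDiffOn_ofReal_comp hΦ
  set b : Fin n → ℂ := fun i => hess (fun p => (Φ p : ℂ)) (dt n) (dz n i) x with hb
  have hsb : (fun i => hess (fun p => (Φ p : ℂ)) (dz n i) (dt n) x) = star b := by
    funext i
    exact (hess_conj hΩ hu (fun y => Complex.conj_ofReal _) _ _ hx).symm
  have hv : (fun i => vlift Φ (some i) x) = -(b ᵥ* (gmet Φ x)⁻¹) := by
    funext i
    simp [vlift, ginv, Matrix.vecMul, dotProduct, hb, wD_wDbar_eq_hess, mul_comm]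
  have hc : cgeo Φ x = hess (fun p => (Φ p : ℂ)) (dt n) (dt n) x
      - b ⬝ᵥ ((gmet Φ x)⁻¹ *ᵥ star b) := by
    rw [← hsb]
    simp only [cgeo, ginv, wD_wDbar_eq_hess, dotProduct, Matrix.mulVec, Finset.mul_sum, hb]
    rw [Finset.sum_comm]
    congr 1
    refine Finset.sum_congr rfl fun i _ => Finset.sum_congr rfl fun j _ => ?_
    ring
  have hdet : IsUnit (gmet Φ x).det := (Matrix.isUnit_iff_isUnit_det _).1 hpos.isUnit
  have hst : star (b ᵥ* (gmet Φ x)⁻¹) = (gmet Φ x)⁻¹ *ᵥ star b := by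
    rw [Matrix.star_vecMul, hpos.isHermitian.inv.eq]
  have h1 : gmet Φ x *ᵥ ((gmet Φ x)⁻¹ *ᵥ star b) = star b := by
    rw [Matrix.mulVec_mulVec, Matrix.mul_nonsing_inv _ hdet, Matrix.one_mulVec]
  have h2 : (b ᵥ* (gmet Φ x)⁻¹) ⬝ᵥ (gmet Φ x *ᵥ star w) = b ⬝ᵥ star w := by
    rw [← Matrix.dotProduct_mulVec, Matrix.mulVec_mulVec, Matrix.nonsing_inv_mul _ hdet,
      Matrix.one_mulVec]
  rw [hess_horiz hΩ hΦ w hx, hsb, hv, hc, sub_neg_eq_add, star_add, hst, Matrix.mulVec_add, h1,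
    add_dotProduct, dotProduct_add, dotProduct_add, h2, ← Matrix.dotProduct_mulVec]
  ring

theorem cgeo_eq_hess_horiz (hΩ : IsOpen Ω) (hΦ : ContDiffOn ℝ ∞ Φ Ω) {x : Etz n} (hx : x ∈ Ω)
    (hpos : (gmet Φ x).PosDef) :
    cgeo Φ x = hess (fun p => (Φ p : ℂ)) (horiz n fun i => vlift Φ (some i) x)
      (horiz n fun i => vlift Φ (some i) x) x := by
  rw [hess_horiz_eq_cgeo_add hΩ hΦ _ hx hpos]; simp

theorem cgeo_re_le_hess_horiz (hΩ : IsOpen Ω) (hΦ : ContDiffOn ℝ ∞ Φ Ω) (w : Fin n → ℂ)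
    {x : Etz n} (hx : x ∈ Ω) (hpos : (gmet Φ x).PosDef) :
    (cgeo Φ x).re ≤ (hess (fun p => (Φ p : ℂ)) (horiz n w) (horiz n w) x).re := by
  rw [hess_horiz_eq_cgeo_add hΩ hΦ w hx hpos, Complex.add_re]
  have h := hpos.posSemidef.re_dotProduct_nonneg (star (w - fun i => vlift Φ (some i) x))
  rw [star_star] at h
  exact le_add_of_nonneg_right h

theorem hess_horiz_re_nonneg (hΩ : IsOpen Ω) {ψ : Etz n → ℝ} (hψ : ContDiffOn ℝ ∞ ψ Ω)
    {x : Etz n} (hx : x ∈ Ω) (hβ : (Matrix.of fun a b : Option (Fin n) =>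
      wD (wDbar (fun p => (ψ p : ℂ)) (dir n b)) (dir n a) x).PosSemidef) (w : Fin n → ℂ) :
    0 ≤ (hess (fun p => (ψ p : ℂ)) (horiz n w) (horiz n w) x).re := by
  have hu := contDiffOn_ofReal_comp hψ
  set W : Option (Fin n) → ℂ := fun a => a.elim 1 w with hW
  have hw : horiz n w = ∑ a, W a • dir n a := by simp [horiz, Fintype.sum_option, hW, dir]
  have h := hβ.re_dotProduct_nonneg (star W)
  rw [star_star] at h
  convert h using 1
  rw [hw, hess_sum_left]
  simp_rw [hess_sum_right hΩ hu _ _ _ _ hx]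
  simp [dotProduct, Matrix.mulVec, wD_wDbar_eq_hess, mul_comm]

/-- A positive definite matrix is congruent to the identity. -/
theorem exists_mul_mul_conjTranspose_eq_one {g : Matrix (Fin n) (Fin n) ℂ} (hg : g.PosDef) :
    ∃ C : Matrix (Fin n) (Fin n) ℂ, C * g * Cᴴ = 1 := by
  open scoped MatrixOrder in
  obtain ⟨B, hB⟩ := CStarAlgebra.nonneg_iff_eq_star_mul_self.mp hg.posSemidef.nonneg
  rw [Matrix.star_eq_conjTranspose] at hB
  have hBu : IsUnit B.det := by
    have h := (Matrix.isUnit_iff_isUnit_det _).1 hg.isUnit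
    rw [hB, Matrix.det_mul] at h
    exact isUnit_of_mul_isUnit_right h
  refine ⟨(B⁻¹)ᴴ, ?_⟩
  rw [hB, Matrix.conjTranspose_conjTranspose, Matrix.mul_assoc, Matrix.mul_assoc,
    Matrix.mul_nonsing_inv _ hBu, Matrix.mul_one, ← Matrix.conjTranspose_mul,
    Matrix.mul_nonsing_inv _ hBu, Matrix.conjTranspose_one]

theorem hess_frame (hΩ : IsOpen Ω) (hΦ : ContDiffOn ℝ ∞ Φ Ω) (C : Matrix (Fin n) (Fin n) ℂ)
    {x : Etz n} (hx : x ∈ Ω) :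
    (Matrix.of fun i j => hess (fun p => (Φ p : ℂ)) (∑ k, C i k • dz n k)
      (∑ k, C j k • dz n k) x) = C * gmet Φ x * Cᴴ := by
  ext i j
  rw [Matrix.of_apply, hess_sum_left, Matrix.mul_assoc, Matrix.mul_apply]
  simp_rw [hess_sum_right hΩ (contDiffOn_ofReal_comp hΦ) _ _ _ _ hx]
  simp [Matrix.mul_apply, gmet_apply, mul_comm]

theorem det_gmet_eq_cexp {ψ : Etz n → ℝ} {x : Etz n} (hpos : (gmet Φ x).PosDef)
    (hMA : Real.log ((gmet Φ x).det.re) = Φ x - ψ x) :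
    (gmet Φ x).det = Complex.exp ((Φ x : ℂ) - (ψ x : ℂ)) := by
  have h := Complex.lt_def.1 hpos.det_pos
  simp only [Complex.zero_re, Complex.zero_im] at h
  rw [← Complex.ofReal_sub, ← hMA, ← Complex.ofReal_exp, Real.exp_log h.1]
  exact Complex.ext rfl h.2.symm

theorem isLocalMin_hess_horiz (hΩ : IsOpen Ω) (hΦ : ContDiffOn ℝ ∞ Φ Ω)
    (hpos : ∀ x ∈ Ω, (gmet Φ x).PosDef) {t₀ : ℂ} {z₀ : Fin n → ℂ} (hp₀ : (t₀, z₀) ∈ Ω)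
    (hmin : IsLocalMin (fun z => (cgeo Φ (t₀, z)).re) z₀) (f : Etz n) (hf : f.1 = 0)
    (α : Fin n → ℂ) :
    IsLocalMin (fun l : ℂ => (hess (fun p => (Φ p : ℂ))
      (horiz n ((fun i => vlift Φ (some i) (t₀, z₀)) + l • α))
      (horiz n ((fun i => vlift Φ (some i) (t₀, z₀)) + l • α)) ((t₀, z₀) + l • f)).re) 0 := by
  have hΩ' : ∀ᶠ l : ℂ in 𝓝 0, (t₀, z₀) + l • f ∈ Ω :=
    (isOpen_line_preimage hΩ (t₀, z₀) f).mem_nhds (by simpa using hp₀)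
  have hcont : Tendsto (fun l : ℂ => z₀ + l • f.2) (𝓝 0) (𝓝 z₀) := by
    have h : Continuous fun l : ℂ => z₀ + l • f.2 := by fun_prop
    simpa using h.tendsto 0
  filter_upwards [hΩ', hcont.eventually hmin] with l hl hl'
  have hle := cgeo_re_le_hess_horiz hΩ hΦ ((fun i => vlift Φ (some i) (t₀, z₀)) + l • α) hl
    (hpos _ hl)
  have hpt : (t₀, z₀) + l • f = (t₀, z₀ + l • f.2) := by ext <;> simp [hf]
  simp only [zero_smul, add_zero]
  rw [← cgeo_eq_hess_horiz hΩ hΦ hp₀ (hpos _ hp₀)]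
  refine le_trans ?_ hle
  rw [hpt]
  exact hl'

theorem cgeo_re_nonneg_and_im_eq_zero (hΩ : IsOpen Ω) (hΦ : ContDiffOn ℝ ∞ Φ Ω)
    (hpos : ∀ x ∈ Ω, (gmet Φ x).PosDef) {ψ : Etz n → ℝ} (hψ : ContDiffOn ℝ ∞ ψ Ω)
    (hMA : ∀ x ∈ Ω, Real.log ((gmet Φ x).det.re) = Φ x - ψ x)
    {t₀ : ℂ} {z₀ : Fin n → ℂ} (hp₀ : (t₀, z₀) ∈ Ω)
    (hβ : (Matrix.of fun a b : Option (Fin n) =>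
        wD (wDbar (fun p => (ψ p : ℂ)) (dir n b)) (dir n a) (t₀, z₀)).PosSemidef)
    (hmin : IsLocalMin (fun z => (cgeo Φ (t₀, z)).re) z₀) :
    0 ≤ (cgeo Φ (t₀, z₀)).re ∧ (cgeo Φ (t₀, z₀)).im = 0 := by
  have hu := contDiffOn_ofReal_comp hΦ
  have hw := contDiffOn_ofReal_comp hψ
  have hr : ∀ y, conj (Φ y : ℂ) = Φ y := fun y => Complex.conj_ofReal _
  rw [cgeo_eq_hess_horiz hΩ hΦ hp₀ (hpos _ hp₀)]
  set v : Fin n → ℂ := fun i => vlift Φ (some i) (t₀, z₀) with hv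
  refine ⟨?_, Complex.conj_eq_iff_im.1 (hess_conj hΩ hu hr _ _ hp₀)⟩
  obtain ⟨C, hC⟩ := exists_mul_mul_conjTranspose_eq_one (hpos _ hp₀)
  have hκ : C.det * Cᴴ.det ≠ 0 := by
    have h := congrArg Matrix.det hC
    rw [Matrix.det_mul, Matrix.det_mul, Matrix.det_one] at h
    intro h0
    rw [mul_right_comm, h0, zero_mul] at h
    exact zero_ne_one h
  have hF : ContDiffOn ℝ ∞ (fun p => (Φ p : ℂ) - (ψ p : ℂ)) Ω := hu.sub hw
  have hmain := hess_re_nonneg_of_isLocalMin hΩ hu hr hF (fun i => ∑ k, C i k • dz n k) hκ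
    (fun y hy => by
      rw [hess_frame hΩ hΦ C hy, Matrix.det_mul, Matrix.det_mul,
        det_gmet_eq_cexp (hpos y hy) (hMA y hy)]
      ring) hp₀ ((hess_frame hΩ hΦ C hp₀).trans hC) (horiz n v) (fun k α => by
      have hα : ∑ i, α i • ∑ k, C i k • dz n k = ∑ k, (α ᵥ* C) k • dz n k := by
        simp only [Finset.smul_sum, smul_smul, Matrix.vecMul, dotProduct, Finset.sum_smul]
        exact Finset.sum_comm
      simp only [hα, horiz_add_smul]
      exact isLocalMin_hess_horiz hΩ hΦ hpos hp₀ hmin _ (by simp [dz, Prod.fst_sum]) _)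
  have hsub : hess (fun p => (Φ p : ℂ) - (ψ p : ℂ)) (horiz n v) (horiz n v) (t₀, z₀)
      = hess (fun p => (Φ p : ℂ)) (horiz n v) (horiz n v) (t₀, z₀)
        - hess (fun p => (ψ p : ℂ)) (horiz n v) (horiz n v) (t₀, z₀) := by
    have h1 (s : ℝ) {a b : Etz n → ℂ} (ha : ContDiffOn ℝ ∞ a Ω) (hb : ContDiffOn ℝ ∞ b Ω)
        (e : Etz n) {y : Etz n} (hy : y ∈ Ω) :
        wirt s (fun p => a p - b p) e y = wirt s a e y - wirt s b e y :=
      wirt_sub (ha.diffAt hΩ hy) (hb.diffAt hΩ hy)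
    rw [hess, wirt_congr_on hΩ (fun y hy => h1 1 hu hw _ hy) hp₀]
    exact h1 (-1) (contDiffOn_wirt hΩ hu 1 _) (contDiffOn_wirt hΩ hw 1 _) _ hp₀
  rw [hsub, Complex.sub_re] at hmain
  linarith [hess_horiz_re_nonneg hΩ hψ hp₀ hβ v]

end GeodesicCurvature

end

/-- **Positivity of the geodesic curvature at a fiberwise local minimum.**
With `Φ`, `g`, `ψ` and `c` as in the main computation (equation (34)), if the full
`(n+1)×(n+1)` complex Hessian of `ψ` in the variables `(t, z)` is positive semidefinite at
`(t₀, z₀) ∈ Ω` and `z ↦ c(t₀, z)` has a local minimum at `z₀`, then `c(t₀, z₀) ≥ 0`. -/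
theorem curvature_nonneg_at_min (n : ℕ) (hn : 1 ≤ n) (Ω : Set (Etz n)) (hΩ : IsOpen Ω)
    (Φ : Etz n → ℝ) (hΦ : ContDiffOn ℝ (⊤ : ℕ∞) Φ Ω)
    (hpos : ∀ x ∈ Ω, (gmet Φ x).PosDef)
    (ψ : Etz n → ℝ) (hψ : ContDiffOn ℝ (⊤ : ℕ∞) ψ Ω)
    (hMA : ∀ x ∈ Ω, Real.log ((gmet Φ x).det.re) = Φ x - ψ x)
    (t₀ : ℂ) (z₀ : Fin n → ℂ) (hp₀ : (t₀, z₀) ∈ Ω)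
    (hβ : (Matrix.of fun a b : Option (Fin n) =>
        wD (wDbar (fun p => (ψ p : ℂ)) (dir n b)) (dir n a) (t₀, z₀)).PosSemidef)
    (hmin : IsLocalMin (fun z => (cgeo Φ (t₀, z)).re) z₀) :
    0 ≤ (cgeo Φ (t₀, z₀)).re ∧ (cgeo Φ (t₀, z₀)).im = 0 := by
  exact cgeo_re_nonneg_and_im_eq_zero hΩ hΦ hpos hψ hMA hp₀ hβ hmin

end
end
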